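/- Let $n \geq 2$, let $D \subseteq \mathbb{R}^n$ be a domain (nonempty open connected set), let $G$ be a subdomain of $D$ whose closure $K = \overline{G}$ is a compact subset of $D$, and let $\delta > 0$, $a > 0$. Suppose $f_m : D \to \mathbb{R}^n$, $m = 1, 2, \ldots$, is a sequence of homeomorphisms of $D$ onto their images such that $|f_m(x) - f_m(y)| \geq \frac{\delta}{2}\exp\{-a/|x-y|^n\}$ for all $x, y \in K$ with $x \neq y$ and all $m$, and suppose $f_m$ converges locally uniformly on $D$ to a map $f : D \to \mathbb{R}^n$. Then the restriction $f|_G$ is a homeomorphism of $G$ onto the open set $f(G)$. -/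

import Mathlib

open Metric Set MeasureTheory Module Polynomial

namespace ContinuousLinearMap

/-- `t ↦ det (1 + t A)` is a polynomial function of degree at most the dimension. -/
theorem exists_polynomial_eval_eq_det_id_add_smul {E : Type*} [NormedAddCommGroup E]
    [NormedSpace ℝ E] [FiniteDimensional ℝ E] (A : E →L[ℝ] E) :
    ∃ p : ℝ[X], p.natDegree ≤ finrank ℝ E ∧
      ∀ t : ℝ, p.eval t = (ContinuousLinearMap.id ℝ E + t • A).det := by
  let b := finBasis ℝ E
  let M := LinearMap.toMatrix b b (A : E →ₗ[ℝ] E)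
  refine ⟨Matrix.det ((X : ℝ[X]) • M.map C + (1 : Matrix _ _ ℝ).map C), ?_, fun t => ?_⟩
  · simpa using Polynomial.natDegree_det_X_add_C_le M 1
  · rw [← coe_evalRingHom, RingHom.map_det]
    have : (ContinuousLinearMap.id ℝ E + t • A).det =
        LinearMap.det (LinearMap.id + t • (A : E →ₗ[ℝ] E)) := rfl
    rw [this, ← LinearMap.det_toMatrix b]
    congr 1
    ext i j
    simp [M, Matrix.one_apply, LinearMap.toMatrix_apply, Finsupp.single_apply, eq_comm,
      apply_ite, add_comm]
    ring

theorem det_ne_zero_iff_range_eq_top {E : Type*} [NormedAddCommGroup E] [NormedSpace ℝ E]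
    [FiniteDimensional ℝ E] {A : E →L[ℝ] E} : A.det ≠ 0 ↔ A.range = ⊤ := by
  rw [← isUnit_iff_ne_zero]
  exact (LinearMap.isUnit_iff_isUnit_det _).symm.trans (LinearMap.isUnit_iff_range_eq_top _)

theorem det_id_add_pos {E : Type*} [NormedAddCommGroup E] [NormedSpace ℝ E]
    [FiniteDimensional ℝ E] {A : E →L[ℝ] E} (hA : ‖A‖ < 1) :
    0 < (ContinuousLinearMap.id ℝ E + A).det := by
  have hne : ∀ s ∈ Icc (0 : ℝ) 1, (ContinuousLinearMap.id ℝ E + s • A).det ≠ 0 := by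
    intro s hs h0
    obtain ⟨v, hv, hv0⟩ := (Submodule.ne_bot_iff _).1 (LinearMap.bot_lt_ker_of_det_eq_zero h0).ne'
    have h1 : v + s • A v = 0 := by simpa using hv
    have h2 : ‖v‖ ≤ ‖A‖ * ‖v‖ := by
      calc ‖v‖ = ‖s • A v‖ := by rw [← norm_neg (s • A v), ← eq_neg_of_add_eq_zero_left h1]
        _ = s * ‖A v‖ := by rw [norm_smul, Real.norm_of_nonneg hs.1]
        _ ≤ 1 * ‖A v‖ := by gcongr; exact hs.2
        _ ≤ ‖A‖ * ‖v‖ := by rw [one_mul]; exact A.le_opNorm v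
    nlinarith [norm_pos_iff.2 hv0]
  by_contra! hle
  have hcont : ContinuousOn (fun s : ℝ => (ContinuousLinearMap.id ℝ E + s • A).det) (Icc 0 1) :=
    (ContinuousLinearMap.continuous_det.comp (by fun_prop)).continuousOn
  obtain ⟨s, hs, h0⟩ := intermediate_value_Icc' zero_le_one hcont
    (show (0 : ℝ) ∈ Icc _ _ from ⟨by simpa using hle, by simp [ContinuousLinearMap.det]⟩)
  exact hne s hs h0

end ContinuousLinearMap

variable {E : Type*} [NormedAddCommGroup E] [InnerProductSpace ℝ E] [FiniteDimensional ℝ E]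

/-- A small `C¹` perturbation of the identity that fixes the unit sphere and maps the closed unit
ball to itself is a bijection of the open unit ball. -/
theorem image_ball_eq_of_perturbation {g : E → E} {K : NNReal} {t : ℝ}
    (hg : ∀ x ∈ closedBall (0 : E) 1, ContDiffAt ℝ 1 g x)
    (hK : LipschitzOnWith K g (closedBall 0 1)) (ht : 0 ≤ t) (htK : t * K < 1)
    (hmap : MapsTo (fun x => x + t • g x) (closedBall 0 1) (closedBall 0 1))
    (hfix : ∀ x ∈ sphere (0 : E) 1, g x = 0) :
    InjOn (fun x => x + t • g x) (ball 0 1) ∧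
      (fun x => x + t • g x) '' ball 0 1 = ball 0 1 := by
  have hinj : InjOn (fun x => x + t • g x) (closedBall 0 1) := by
    intro x hx y hy hxy
    by_contra hne
    have h1 : x - y = t • (g y - g x) := by
      have : x + t • g x = y + t • g y := hxy
      rw [smul_sub, sub_eq_sub_iff_add_eq_add, this, add_comm]
    have h2 : ‖x - y‖ ≤ t * (K * ‖x - y‖) := by
      calc ‖x - y‖ = t * ‖g y - g x‖ := by rw [h1, norm_smul, Real.norm_of_nonneg ht]
        _ ≤ t * (K * ‖x - y‖) := by
          gcongr
          rw [norm_sub_rev x]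
          simpa [dist_eq_norm] using hK.dist_le_mul y hy x hx
    nlinarith [norm_pos_iff.2 (sub_ne_zero.2 hne)]
  have hcd : ∀ x ∈ closedBall (0 : E) 1, ContDiffAt ℝ 1 (fun x => x + t • g x) x :=
    fun x hx => contDiffAt_id.add (contDiffAt_const.smul (hg x hx))
  have hopen : IsOpen ((fun x => x + t • g x) '' ball 0 1) := by
    rw [isOpen_iff_mem_nhds]
    rintro _ ⟨x, hx, rfl⟩
    have hx' := ball_subset_closedBall hx
    have hd : HasStrictFDerivAt (fun x => x + t • g x)
        (ContinuousLinearMap.id ℝ E + t • fderiv ℝ g x) x :=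
      (hasStrictFDerivAt_id x).add (((hg x hx').hasStrictFDerivAt one_ne_zero).const_smul t)
    have hn : ‖t • fderiv ℝ g x‖ < 1 := by
      rw [norm_smul, Real.norm_of_nonneg ht]
      refine lt_of_le_of_lt ?_ htK
      gcongr
      exact norm_fderiv_le_of_lipschitzOn ℝ (closedBall_mem_nhds_of_mem hx) hK
    have hdet := (ContinuousLinearMap.det_id_add_pos hn).ne'
    rw [← hd.map_nhds_eq_of_surj (ContinuousLinearMap.det_ne_zero_iff_range_eq_top.1 hdet)]
    exact Filter.image_mem_map (isOpen_ball.mem_nhds hx)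
  have hsub : (fun x => x + t • g x) '' ball 0 1 ⊆ ball 0 1 := by
    rw [← interior_closedBall (0 : E) one_ne_zero]
    refine interior_maximal ?_ (by rwa [interior_closedBall (0 : E) one_ne_zero])
    rw [interior_closedBall (0 : E) one_ne_zero]
    exact (image_mono ball_subset_closedBall).trans hmap.image_subset
  refine ⟨hinj.mono ball_subset_closedBall, hsub.antisymm ?_⟩
  have hcompact : IsCompact ((fun x => x + t • g x) '' closedBall 0 1) :=
    (isCompact_closedBall 0 1).image_of_continuousOn
      fun x hx => (hcd x hx).continuousAt.continuousWithinAt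
  refine (convex_ball (0 : E) 1).isPreconnected.subset_of_closure_inter_subset hopen ?_ ?_
  · obtain ⟨y, hy⟩ := (nonempty_ball (x := (0 : E))).2 one_pos
    exact ⟨_, hsub ⟨y, hy, rfl⟩, y, hy, rfl⟩
  · rintro y ⟨hy, hyb⟩
    obtain ⟨x, hx, rfl⟩ := closure_minimal (image_mono ball_subset_closedBall)
      hcompact.isClosed hy
    refine ⟨x, ?_, rfl⟩
    by_contra hxb
    have hxs : x ∈ sphere (0 : E) 1 := by
      simp only [mem_sphere, mem_closedBall, mem_ball] at *; linarith
    simp [hfix x hxs] at hyb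
    exact hxb (by simpa using hyb)

/-- There is no `C¹` retraction of the closed unit ball onto the unit sphere. -/
theorem not_contDiff_retraction_sphere {r : E → E}
    (hr : ∀ x ∈ closedBall (0 : E) 1, ContDiffAt ℝ 1 r x)
    (hnorm : ∀ x ∈ closedBall (0 : E) 1, ‖r x‖ = 1) (hfix : ∀ x ∈ sphere (0 : E) 1, r x = x) :
    False := by
  borelize E
  let g : E → E := fun x => r x - x
  have hg : ∀ x ∈ closedBall (0 : E) 1, ContDiffAt ℝ 1 g x :=
    fun x hx => (hr x hx).sub contDiffAt_id
  obtain ⟨K, hK⟩ := ContDiffOn.exists_lipschitzOnWith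
    (fun x hx => (hg x hx).contDiffWithinAt) one_ne_zero (convex_closedBall (0 : E) 1)
    (isCompact_closedBall 0 1)
  have hvol : ∀ t : ℝ, 0 ≤ t → t ≤ 1 → t * K < 1 →
      ∫ x in ball (0 : E) 1, (ContinuousLinearMap.id ℝ E + t • fderiv ℝ g x).det =
        volume.real (ball (0 : E) 1) := by
    intro t ht0 ht1 htK
    obtain ⟨hinj, himg⟩ := image_ball_eq_of_perturbation hg hK ht0 htK
      (fun x hx => by
        have hseg : x + t • g x = (1 - t) • x + t • r x := by
          simp only [g, smul_sub, sub_smul, one_smul]; abel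
        simp only [hseg]
        exact convex_closedBall (0 : E) 1 hx (by simp [hnorm x hx]) (by linarith) ht0 (by ring))
      (fun x hx => by simp [g, hfix x hx])
    have h := integral_image_eq_integral_abs_det_fderiv_smul volume
      (f := fun x => x + t • g x) (f' := fun x => ContinuousLinearMap.id ℝ E + t • fderiv ℝ g x)
      measurableSet_ball (fun x hx =>
        ((hasFDerivAt_id x).add (((hg x (ball_subset_closedBall hx)).differentiableAt
          one_ne_zero).hasFDerivAt.const_smul t)).hasFDerivWithinAt) hinj (fun _ => (1 : ℝ))
    rw [himg] at h
    simp only [integral_const, smul_eq_mul, mul_one, measureReal_restrict_apply_univ] at h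
    rw [h]
    refine setIntegral_congr_fun measurableSet_ball fun x hx => ?_
    refine (abs_of_pos (ContinuousLinearMap.det_id_add_pos ?_)).symm
    rw [norm_smul, Real.norm_of_nonneg ht0]
    refine lt_of_le_of_lt ?_ htK
    gcongr
    exact norm_fderiv_le_of_lipschitzOn ℝ (closedBall_mem_nhds_of_mem hx) hK
  have hint : ∀ t : ℝ, IntegrableOn
      (fun x => (ContinuousLinearMap.id ℝ E + t • fderiv ℝ g x).det) (ball (0 : E) 1) := by
    intro t
    refine IntegrableOn.mono_set (ContinuousOn.integrableOn_compact (isCompact_closedBall 0 1)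
      (ContinuousLinearMap.continuous_det.comp_continuousOn
        (continuousOn_const.add (ContinuousOn.const_smul ?_ t)))) ball_subset_closedBall
    exact fun x hx => ((hg x hx).fderiv_right (m := 0) le_rfl).continuousAt.continuousWithinAt
  let N := finrank ℝ E + 1
  let v : ℕ → ℝ := fun i => i / (N * (K + 1))
  have hNpos : (0 : ℝ) < N := by positivity
  have hv : InjOn v (Finset.range N) := by
    intro i _ j _ hij
    have : (N * (K + 1) : ℝ) ≠ 0 := by positivity
    simpa [v, div_left_inj' this] using hij
  have hvlt : ∀ i ∈ Finset.range N, 0 ≤ v i ∧ v i ≤ 1 ∧ v i * K < 1 := by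
    intro i hi
    have hi' : (i : ℝ) < N := by exact_mod_cast Finset.mem_range.1 hi
    have hlt : v i * (K + 1) < 1 := by
      have : v i * (K + 1) = i / N := by simp only [v]; field_simp
      rw [this, div_lt_one hNpos]; exact hi'
    have h0 : 0 ≤ v i := by positivity
    have hK0 : (0 : ℝ) ≤ K := K.2
    exact ⟨h0, by nlinarith, by nlinarith⟩
  have hinterp : ∀ x, ∀ t : ℝ, (ContinuousLinearMap.id ℝ E + t • fderiv ℝ g x).det =
      ∑ i ∈ Finset.range N, (ContinuousLinearMap.id ℝ E + v i • fderiv ℝ g x).det *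
        (Lagrange.basis (Finset.range N) v i).eval t := by
    intro x t
    obtain ⟨p, hdeg, hp⟩ :=
      ContinuousLinearMap.exists_polynomial_eval_eq_det_id_add_smul (fderiv ℝ g x)
    have hlt : p.degree < (Finset.range N).card := by
      rw [Finset.card_range]
      exact (Polynomial.degree_le_natDegree.trans_lt (by exact_mod_cast Nat.lt_succ_of_le hdeg))
    have := congrArg (Polynomial.eval t) (Lagrange.eq_interpolate hv hlt)
    rw [hp, Lagrange.interpolate_apply, Polynomial.eval_finsetSum] at this
    simpa [hp] using this
  have hone : ∫ x in ball (0 : E) 1, (ContinuousLinearMap.id ℝ E + (1 : ℝ) • fderiv ℝ g x).det =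
      volume.real (ball (0 : E) 1) := by
    simp_rw [hinterp _ 1]
    rw [integral_finsetSum _ fun i _ => (hint (v i)).mul_const _]
    simp_rw [integral_mul_const]
    rw [Finset.sum_congr rfl fun i hi => by
      rw [hvol (v i) (hvlt i hi).1 (hvlt i hi).2.1 (hvlt i hi).2.2], ← Finset.mul_sum,
      ← Polynomial.eval_finsetSum, Lagrange.sum_basis hv (by simp [N])]
    simp
  have hzero : ∫ x in ball (0 : E) 1,
      (ContinuousLinearMap.id ℝ E + (1 : ℝ) • fderiv ℝ g x).det = 0 := by
    refine setIntegral_eq_zero_of_forall_eq_zero fun x hx => ?_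
    have hx' := ball_subset_closedBall hx
    have hd : DifferentiableAt ℝ r x := (hr x hx').differentiableAt one_ne_zero
    have hfd : ContinuousLinearMap.id ℝ E + (1 : ℝ) • fderiv ℝ g x = fderiv ℝ r x := by
      have : fderiv ℝ g x = fderiv ℝ r x - ContinuousLinearMap.id ℝ E :=
        (hd.hasFDerivAt.sub (hasFDerivAt_id x)).fderiv
      rw [this, one_smul]; abel
    rw [hfd]
    by_contra hdet
    obtain ⟨w, hw⟩ := LinearMap.range_eq_top.1
      (ContinuousLinearMap.det_ne_zero_iff_range_eq_top.1 hdet) (r x)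
    have hconst : (fun y : E => inner ℝ (r y) (r y)) =ᶠ[nhds x] fun _ => (1 : ℝ) := by
      filter_upwards [isOpen_ball.mem_nhds hx] with y hy
      rw [real_inner_self_eq_norm_sq, hnorm y (ball_subset_closedBall hy), one_pow]
    have h2 := congrArg (fun L : E →L[ℝ] ℝ => L w) (hconst.fderiv_eq (𝕜 := ℝ))
    have hw' : fderiv ℝ r x w = r x := hw
    rw [fderiv_inner_apply ℝ hd hd, hw', real_inner_self_eq_norm_sq, hnorm x hx'] at h2
    norm_num at h2
  have hpos : 0 < volume.real (ball (0 : E) 1) :=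
    ENNReal.toReal_pos (measure_ball_pos volume 0 one_pos).ne' measure_ball_lt_top.ne
  linarith

theorem exists_fixedPoint_closedBall_of_contDiff {Q : E → E} (hQ : ContDiff ℝ 1 Q)
    (hlt : ∀ x ∈ closedBall (0 : E) 1, ‖Q x‖ < 1) : ∃ x ∈ closedBall (0 : E) 1, Q x = x := by
  by_contra! hne
  let v : E → E := fun x => x - Q x
  let d : E → ℝ := fun x => inner ℝ x (v x) ^ 2 + ‖v x‖ ^ 2 * (1 - ‖x‖ ^ 2)
  have hv : ∀ x ∈ closedBall (0 : E) 1, 0 < ‖v x‖ ^ 2 := fun x hx =>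
    pow_pos (norm_pos_iff.2 (sub_ne_zero.2 (hne x hx).symm)) 2
  have hinner : ∀ x ∈ sphere (0 : E) 1, 0 < inner ℝ x (v x) := by
    intro x hx
    have h1 : ‖x‖ = 1 := by simpa using hx
    have h2 := real_inner_le_norm x (Q x)
    have h3 := hlt x (sphere_subset_closedBall hx)
    simp only [v, inner_sub_right, real_inner_self_eq_norm_sq, h1]
    rw [h1] at h2
    linarith
  have hd : ∀ x ∈ closedBall (0 : E) 1, 0 < d x := by
    intro x hx
    have hx1 : ‖x‖ ≤ 1 := by simpa using hx
    rcases hx1.lt_or_eq with h | h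
    · have : 0 < 1 - ‖x‖ ^ 2 := by nlinarith [norm_nonneg x]
      have := mul_pos (hv x hx) this
      positivity
    · have := hinner x (by simpa using h)
      simp only [d, h]
      simpa using pow_pos this 2
  have hvc : ContDiff ℝ 1 v := contDiff_id.sub hQ
  have hdc : ContDiff ℝ 1 d :=
    ((contDiff_id.inner ℝ hvc).pow 2).add
      ((hvc.norm_sq ℝ).mul (contDiff_const.sub (contDiff_norm_sq ℝ)))
  refine not_contDiff_retraction_sphere
    (r := fun x => x + ((√(d x) - inner ℝ x (v x)) / ‖v x‖ ^ 2) • v x) ?_ ?_ ?_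
  · intro x hx
    exact contDiffAt_id.add ((((hdc.contDiffAt.sqrt (hd x hx).ne').sub
      (contDiff_id.inner ℝ hvc).contDiffAt).div (hvc.norm_sq ℝ).contDiffAt (hv x hx).ne').smul
        hvc.contDiffAt)
  · intro x hx
    have hv' : ‖v x‖ ≠ 0 := fun h => (hv x hx).ne' (by simp [h])
    rw [← sq_eq_sq₀ (norm_nonneg _) zero_le_one, norm_add_sq_real, inner_smul_right, norm_smul,
      mul_pow, Real.norm_eq_abs, sq_abs]
    have hs := Real.sq_sqrt (hd x hx).le
    field_simp
    have : d x = inner ℝ x (v x) ^ 2 + ‖v x‖ ^ 2 * (1 - ‖x‖ ^ 2) := rfl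
    linear_combination hs + this
  · intro x hx
    have h1 : ‖x‖ = 1 := by simpa using hx
    simp [d, h1, Real.sqrt_sq (hinner x hx).le]

/-- **Brouwer fixed point theorem** for the closed unit ball. -/
theorem exists_fixedPoint_closedBall {h : E → E} (hc : ContinuousOn h (closedBall 0 1))
    (hm : MapsTo h (closedBall 0 1) (closedBall 0 1)) : ∃ x ∈ closedBall (0 : E) 1, h x = x := by
  by_contra! hne
  obtain ⟨H, hH⟩ := ContinuousMap.exists_restrict_eq (isClosed_closedBall (x := (0 : E)) (ε := 1))
    ⟨_, hc.domRestrict⟩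
  have hHh : ∀ x ∈ closedBall (0 : E) 1, H x = h x := fun x hx =>
    congrArg (fun k : C(closedBall (0 : E) 1, E) => k ⟨x, hx⟩) hH
  obtain ⟨ε, hε, hεle⟩ := (isCompact_closedBall (0 : E) 1).exists_forall_le'
    (f := fun x => ‖H x - x‖) (by fun_prop) (a := 0)
    fun x hx => norm_pos_iff.2 (sub_ne_zero.2 (by rw [hHh x hx]; exact hne x hx))
  obtain ⟨P, hP, hPH, -⟩ := H.continuous.exists_contDiff_approx (ε := fun _ => ε / 2) 1
    continuous_const (fun _ => by positivity)
  have hQ : ∀ x ∈ closedBall (0 : E) 1, ‖P x‖ < 1 + ε / 2 := by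
    intro x hx
    have h1 : ‖H x‖ ≤ 1 := by rw [hHh x hx]; simpa using hm hx
    have h2 := hPH x
    rw [dist_eq_norm] at h2
    linarith [norm_le_insert' (P x) (H x)]
  have hpos : 0 < 1 + ε / 2 := by positivity
  obtain ⟨x, hx, hfix⟩ := exists_fixedPoint_closedBall_of_contDiff
    (Q := fun x => (1 + ε / 2)⁻¹ • P x) (contDiff_const.smul (by exact_mod_cast hP)) fun x hx => by
      rw [norm_smul, norm_inv, Real.norm_of_nonneg hpos.le, inv_mul_lt_one₀ hpos]
      exact hQ x hx
  have hPx : P x = (1 + ε / 2) • x := by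
    rw [← inv_smul_eq_iff₀ hpos.ne', hfix]
  have h2 := hPH x
  rw [dist_eq_norm, hPx, add_smul, one_smul, norm_sub_rev] at h2
  have h3 := norm_add_le (H x - (x + (ε / 2) • x)) ((ε / 2) • x)
  rw [norm_smul, Real.norm_of_nonneg (by positivity : 0 ≤ ε / 2)] at h3
  have h4 := hεle x hx
  have h5 : H x - (x + (ε / 2) • x) + (ε / 2) • x = H x - x := by abel
  rw [h5] at h3
  have h6 : ‖x‖ ≤ 1 := by simpa using hx
  nlinarith

theorem image_closedBall_mem_nhds_of_injOn {f : E → E} (hc : ContinuousOn f (closedBall 0 1))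
    (hi : InjOn f (closedBall 0 1)) : f '' closedBall 0 1 ∈ nhds (f 0) := by
  borelize E
  have h0 : (0 : E) ∈ closedBall (0 : E) 1 := by simp
  have hS : IsCompact (f '' closedBall 0 1) := (isCompact_closedBall 0 1).image_of_continuousOn hc
  have : CompactSpace (closedBall (0 : E) 1) :=
    isCompact_iff_compactSpace.1 (isCompact_closedBall 0 1)
  have hemb : Topology.IsClosedEmbedding ((closedBall (0 : E) 1).domRestrict f) :=
    hc.domRestrict.isClosedEmbedding hi.injective
  obtain ⟨G, hG⟩ := ContinuousMap.exists_extension hemb ⟨Subtype.val, continuous_subtype_val⟩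
  have hGf : ∀ x ∈ closedBall (0 : E) 1, G (f x) = x := fun x hx =>
    congrArg (fun k : C(closedBall (0 : E) 1, E) => k ⟨x, hx⟩) hG
  have hstable : ∀ T : E → E, ContinuousOn T (f '' closedBall 0 1) →
      (∀ y ∈ f '' closedBall 0 1, ‖G y - T y‖ ≤ 1) → ∃ y ∈ f '' closedBall 0 1, T y = 0 := by
    intro T hT hle
    obtain ⟨x, hx, hfix⟩ := exists_fixedPoint_closedBall (h := fun x => x - T (f x))
      (continuousOn_id.sub (hT.comp hc (mapsTo_image _ _))) fun x hx => by
        have := hle _ (mem_image_of_mem f hx)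
        rw [hGf x hx] at this
        simpa using this
    exact ⟨f x, mem_image_of_mem f hx, by simpa using hfix⟩
  by_contra hnhds
  obtain ⟨ε', hε', hsmall⟩ := Metric.continuousAt_iff.1 (G.continuous.continuousAt (x := f 0))
    (1 / 10) (by norm_num)
  rw [hGf 0 h0] at hsmall
  obtain ⟨ε, hε, hεε⟩ : ∃ ε > 0, 2 * ε = ε' := ⟨ε' / 2, by positivity, by ring⟩
  obtain ⟨c, hcball, hcS⟩ := not_subset.1 fun h => hnhds (Metric.mem_nhds_iff.2 ⟨ε, hε, h⟩)
  rw [mem_ball'] at hcball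
  have hGsmall : ∀ y, ‖y - c‖ ≤ ε → ‖G y‖ < 1 / 10 := by
    intro y hy
    rw [← dist_zero_right]
    refine hsmall ?_
    rw [← dist_eq_norm] at hy
    linarith [dist_triangle_right y (f 0) c]
  obtain ⟨δ, hδ, hδle⟩ := (hS.inter_right
    (isClosed_le continuous_const (continuous_id.sub continuous_const).norm :
      IsClosed {y : E | ε ≤ ‖y - c‖})).exists_forall_le' (f := fun y => ‖G y‖) (by fun_prop)
      (a := 0) (by
        rintro _ ⟨⟨x, hx, rfl⟩, hxc⟩
        rw [hGf x hx, norm_pos_iff]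
        rintro rfl
        rw [mem_ofPred_eq, ← dist_eq_norm] at hxc
        linarith)
  obtain ⟨η, hη, hηδ, hη1⟩ : ∃ η > 0, 2 * η ≤ δ ∧ 2 * η ≤ 1 / 10 :=
    ⟨min δ (1 / 10) / 2, by positivity, by linarith [min_le_left δ (1 / 10)],
      by linarith [min_le_right δ (1 / 10)]⟩
  obtain ⟨P, hP, hPG, -⟩ := G.continuous.exists_contDiff_approx (ε := fun _ => η) 1
    continuous_const (fun _ => hη)
  have hnull : volume (P '' sphere c ε) = 0 :=
    addHaar_image_eq_zero_of_differentiableOn_of_addHaar_eq_zero volume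
      (hP.differentiable (by norm_num)).differentiableOn
      (Measure.addHaar_sphere_of_ne_zero volume c hε.ne')
  obtain ⟨w, hw, hwP⟩ : ∃ w ∈ ball (0 : E) η, w ∉ P '' sphere c ε := by
    refine not_subset.1 fun h => (measure_ball_pos volume (0 : E) hη).ne' ?_
    exact measure_mono_null h hnull
  rw [mem_ball_zero_iff] at hw
  have hclose : ∀ y, ‖G y - (P y - w)‖ < 2 * η := by
    intro y
    have h1 := hPG y
    rw [dist_comm, dist_eq_norm] at h1
    have h2 : G y - (P y - w) = (G y - P y) + w := by abel
    rw [h2]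
    linarith [norm_add_le (G y - P y) w]
  let φ : E → E := fun y => c + max (ε / ‖y - c‖) 1 • (y - c)
  have hφ1 : ∀ y, ε ≤ ‖y - c‖ → φ y = y := by
    intro y hy
    have : ε / ‖y - c‖ ≤ 1 := div_le_one_of_le₀ hy (norm_nonneg _)
    simp [φ, max_eq_right this]
  have hφ2 : ∀ y, y ≠ c → ‖y - c‖ ≤ ε → ‖φ y - c‖ = ε := by
    intro y hyc hy
    have hpos : 0 < ‖y - c‖ := norm_pos_iff.2 (sub_ne_zero.2 hyc)
    have : 1 ≤ ε / ‖y - c‖ := (one_le_div hpos).2 hy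
    simp only [φ, max_eq_left this, add_sub_cancel_left, norm_smul, norm_div, norm_norm,
      Real.norm_of_nonneg hε.le]
    field_simp
  have hne : ∀ y ∈ f '' closedBall 0 1, y ≠ c := fun y hy h => hcS (h ▸ hy)
  obtain ⟨y, hy, hy0⟩ := hstable (fun y => P (φ y) - w)
    (by
      refine (hP.continuous.comp_continuousOn ?_).sub continuousOn_const
      have hsub : ContinuousOn (fun y => y - c) (f '' closedBall 0 1) := by fun_prop
      exact continuousOn_const.add (((continuousOn_const.div hsub.norm fun y hy =>
        (norm_pos_iff.2 (sub_ne_zero.2 (hne y hy))).ne').sup continuousOn_const).smul hsub))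
    (by
      intro y hy
      rcases le_total ε ‖y - c‖ with h | h
      · rw [hφ1 y h]
        linarith [hclose y]
      · have h1 := hGsmall y h
        have h2 := hGsmall (φ y) (hφ2 y (hne y hy) h).le
        have h3 := hclose (φ y)
        have h4 : G y - (P (φ y) - w) = G y - G (φ y) + (G (φ y) - (P (φ y) - w)) := by abel
        rw [h4]
        linarith [norm_add_le (G y - G (φ y)) (G (φ y) - (P (φ y) - w)),
          norm_sub_le (G y) (G (φ y))])
  rcases le_total ε ‖y - c‖ with h | h
  · have h1 := hclose y
    rw [hφ1 y h] at hy0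
    rw [hy0, sub_zero] at h1
    linarith [hδle y ⟨hy, h⟩]
  · exact hwP ⟨φ y, by simpa [dist_eq_norm] using hφ2 y (hne y hy) h, sub_eq_zero.1 hy0⟩

/-- **Invariance of domain**: a continuous injective map from an open subset of a Euclidean space
to the space itself has open image. -/
theorem IsOpen.image_of_continuousOn_injOn {f : E → E} {U : Set E} (hU : IsOpen U)
    (hc : ContinuousOn f U) (hi : InjOn f U) : IsOpen (f '' U) := by
  rw [isOpen_iff_mem_nhds]
  rintro _ ⟨x, hx, rfl⟩
  obtain ⟨ρ, hρ, hsub⟩ := Metric.nhds_basis_closedBall.mem_iff.1 (hU.mem_nhds hx)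
  have hmaps : MapsTo (fun z => x + ρ • z) (closedBall 0 1) U := by
    intro z hz
    refine hsub ?_
    rw [mem_closedBall_zero_iff] at hz
    rw [mem_closedBall, dist_eq_norm, add_sub_cancel_left, norm_smul, Real.norm_of_nonneg hρ.le]
    nlinarith
  have hinj : InjOn (fun z => x + ρ • z) (closedBall 0 1) := by
    intro y _ z _ hyz
    simpa [hρ.ne'] using hyz
  have h := image_closedBall_mem_nhds_of_injOn (f := f ∘ fun z => x + ρ • z)
    (hc.comp (by fun_prop) hmaps) (hi.comp hinj hmaps)
  rw [image_comp] at h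
  simpa using Filter.mem_of_superset h (image_mono hmaps.image_subset)

/-- A locally uniform limit on a domain `D ⊆ ℝⁿ` of homeomorphisms
(onto their images) satisfying the lower distance bound on `K = closure G`
(with `G` a compactly contained subdomain of `D`) restricts to a homeomorphism
of `G` onto the open set `F '' G`. -/
theorem limit_homeomorph_euclidean {n : ℕ} (hn : 2 ≤ n)
    (D G : Set (EuclideanSpace ℝ (Fin n)))
    (hDopen : IsOpen D) (hDconn : IsConnected D)
    (hGopen : IsOpen G) (hGconn : IsConnected G) (hGD : G ⊆ D)
    (hKcompact : IsCompact (closure G)) (hKD : closure G ⊆ D)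
    (δ a : ℝ) (hδ : 0 < δ) (ha : 0 < a)
    (f : ℕ → EuclideanSpace ℝ (Fin n) → EuclideanSpace ℝ (Fin n))
    (hhomeo : ∀ m : ℕ, Topology.IsEmbedding (fun x : D => f m x))
    (hlow : ∀ m : ℕ, ∀ x ∈ closure G, ∀ y ∈ closure G, x ≠ y →
      δ / 2 * Real.exp (-a / dist x y ^ n) ≤ dist (f m x) (f m y))
    (F : EuclideanSpace ℝ (Fin n) → EuclideanSpace ℝ (Fin n))
    (hconv : TendstoLocallyUniformlyOn (fun m => f m) F Filter.atTop D) :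
    IsOpen (F '' G) ∧ Topology.IsEmbedding (fun x : G => F x) := by
  have hcont : ContinuousOn F G :=
    (hconv.continuousOn (.of_forall fun m =>
      continuousOn_iff_continuous_domRestrict.2 (hhomeo m).continuous)).mono hGD
  have hinj : InjOn F G := by
    intro x hx y hy hxy
    by_contra hne
    have hlim := (hconv.tendsto_at (hGD hx)).dist (hconv.tendsto_at (hGD hy))
    have hle := ge_of_tendsto' hlim fun m => hlow m x (subset_closure hx) y (subset_closure hy) hne
    rw [hxy, dist_self] at hle
    have : 0 < δ / 2 * Real.exp (-a / dist x y ^ n) := by positivity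
    linarith
  refine ⟨hGopen.image_of_continuousOn_injOn hcont hinj,
    (Topology.IsOpenEmbedding.of_continuous_injective_isOpenMap hcont.domRestrict hinj.injective
      fun V hV => ?_).isEmbedding⟩
  have hV' : G.domRestrict F '' V = F '' (Subtype.val '' V) := by
    rw [image_image]; rfl
  have hVG : Subtype.val '' V ⊆ G := by simp
  rw [hV']
  exact (hGopen.isOpenMap_subtype_val V hV).image_of_continuousOn_injOn (hcont.mono hVG)
    (hinj.mono hVG)
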